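/- Let (X,d) be an (R,D)-thin metric space. Let l : [0,Λ] → X be a segment with Λ ≥ 10R, and let l̄ : [0,M] → X be a segment with l̄(0) = l(0) such that π_l(l̄(M)) ⊆ l([0,R]) ∪ l([Λ−R, Λ]). If π_l(l̄([0,M])) ∩ l([3R, Λ−3R]) ≠ ∅, then π_l(l̄([0,M])) contains a 3D-net of l([R, Λ−R]). -/

import Mathlib

open Metric Set

/-- `l` restricted to `[a, b]` is a unit-speed segment (isometric embedding of `[a,b]`). -/
def IsSegmentOn {X : Type*} [PseudoMetricSpace X] (l : ℝ → X) (a b : ℝ) : Prop :=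
  ∀ s ∈ Set.Icc a b, ∀ t ∈ Set.Icc a b, dist (l s) (l t) = |s - t|

/-- A ray in `X`: an isometric embedding of `[0, ∞)`. -/
def IsRay {X : Type*} [PseudoMetricSpace X] (r : ℝ → X) : Prop :=
  ∀ s t : ℝ, 0 ≤ s → 0 ≤ t → dist (r s) (r t) = |s - t|

/-- `X` is a geodesic space: any two points are joined by a segment. -/
def IsGeodesicSpace (X : Type*) [PseudoMetricSpace X] : Prop :=
  ∀ x y : X, ∃ f : ℝ → X, IsSegmentOn f 0 (dist x y) ∧ f 0 = x ∧ f (dist x y) = y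

/-- The metric projection of a point `x` to a set `K`:
the set of points of `K` realizing the distance from `x` to `K`. -/
def metricProj {X : Type*} [PseudoMetricSpace X] (K : Set X) (x : X) : Set X :=
  {y ∈ K | dist x y = Metric.infDist x K}

/-- The metric projection of a set `A` to a set `K`. -/
def metricProjSet {X : Type*} [PseudoMetricSpace X] (K A : Set X) : Set X :=
  ⋃ x ∈ A, metricProj K x

/-- `S` contains a `c`-net of `T`: every point of `T` is within distance `c` of `S`. -/
def ContainsNetOf {X : Type*} [PseudoMetricSpace X] (S T : Set X) (c : ℝ) : Prop :=
  ∀ p ∈ T, ∃ q ∈ S, dist p q ≤ c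

/-- An `(R,D)`-thin metric space: a proper, separable, geodesic metric space
(with `R ≥ 20 D > 0`) such that for every segment `l` of length `L > 2R`, every
`t ∈ (R, L - R)` and every `x` whose projection to `l` meets `l(t)`, one has
`dist(x, l) < D`. -/
structure IsThinSpace (X : Type*) [MetricSpace X] (R D : ℝ) : Prop where
  R_pos : 0 < R
  D_pos : 0 < D
  twentyD_le_R : 20 * D ≤ R
  proper : ProperSpace X
  separable : TopologicalSpace.SeparableSpace X
  geodesic : IsGeodesicSpace X
  thin : ∀ (l : ℝ → X) (L : ℝ), 2 * R < L → IsSegmentOn l 0 L →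
    ∀ t ∈ Set.Ioo R (L - R), ∀ x : X,
      dist x (l t) = Metric.infDist x (l '' Set.Icc 0 L) →
      Metric.infDist x (l '' Set.Icc 0 L) < D

theorem IsSegmentOn.continuousOn {X : Type*} [PseudoMetricSpace X] {l : ℝ → X} {a b : ℝ}
    (hl : IsSegmentOn l a b) : ContinuousOn l (Icc a b) :=
  (LipschitzOnWith.of_dist_le_mul (K := 1) fun s hs t ht => by
    rw [hl s hs t ht, Real.dist_eq, NNReal.coe_one, one_mul]).continuousOn

theorem IsSegmentOn.mono {X : Type*} [PseudoMetricSpace X] {l : ℝ → X} {a b a' b' : ℝ}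
    (hl : IsSegmentOn l a b) (ha : a ≤ a') (hb : b' ≤ b) : IsSegmentOn l a' b' :=
  fun s hs t ht => hl s (Icc_subset_Icc ha hb hs) t (Icc_subset_Icc ha hb ht)

/-- Every point has a nearest point on a segment. -/
theorem IsSegmentOn.exists_infDist_eq_dist {X : Type*} [PseudoMetricSpace X] {l : ℝ → X}
    {a b : ℝ} (hl : IsSegmentOn l a b) (hab : a ≤ b) (x : X) :
    ∃ t ∈ Icc a b, infDist x (l '' Icc a b) = dist x (l t) := by
  obtain ⟨_, ⟨t, ht, rfl⟩, h⟩ := (isCompact_Icc.image_of_continuousOn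
    hl.continuousOn).exists_infDist_eq_dist ((nonempty_Icc.2 hab).image l) x
  exact ⟨t, ht, h⟩

/-- Two nearest points on a segment, one of which lies in its middle part, are `2D`-close. -/
theorem IsThinSpace.abs_sub_lt {X : Type*} [MetricSpace X] {R D : ℝ} (hX : IsThinSpace X R D)
    {l : ℝ → X} {Λ : ℝ} (hl : IsSegmentOn l 0 Λ) {x : X} {s t : ℝ}
    (hs : s ∈ Ioo R (Λ - R)) (ht : t ∈ Icc 0 Λ)
    (hxs : dist x (l s) = infDist x (l '' Icc 0 Λ))
    (hxt : dist x (l t) = infDist x (l '' Icc 0 Λ)) : |s - t| < 2 * D := by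
  have hR := hX.R_pos
  have hD := hX.thin l Λ (by linarith [hs.1, hs.2]) hl s hs x hxs
  have htri := dist_triangle_left (l s) (l t) x
  rw [hl s ⟨by linarith [hs.1], by linarith [hs.2]⟩ t ht] at htri
  linarith

/-- Splitting a segment `l` at a point `p`, a path which starts nearest to the part before `p`
and ends nearest to the part after `p` has a point with nearest points in both parts. -/
theorem IsSegmentOn.exists_nearest_both_sides {X : Type*} [PseudoMetricSpace X] {l : ℝ → X}
    {Λ : ℝ} (hl : IsSegmentOn l 0 Λ) {γ : ℝ → X} {M : ℝ} (hM : 0 ≤ M)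
    (hγ : ContinuousOn γ (Icc 0 M)) {p s₀ s₁ : ℝ} (hs₀ : s₀ ∈ Icc 0 p) (hs₁ : s₁ ∈ Icc p Λ)
    (h₀ : dist (γ 0) (l s₀) = infDist (γ 0) (l '' Icc 0 Λ))
    (h₁ : dist (γ M) (l s₁) = infDist (γ M) (l '' Icc 0 Λ)) :
    ∃ u ∈ Icc 0 M, ∃ t₁ ∈ Icc 0 p, ∃ t₂ ∈ Icc p Λ,
      dist (γ u) (l t₁) = infDist (γ u) (l '' Icc 0 Λ) ∧
      dist (γ u) (l t₂) = infDist (γ u) (l '' Icc 0 Λ) := by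
  have hp₀ : 0 ≤ p := hs₀.1.trans hs₀.2
  have hpΛ : p ≤ Λ := hs₁.1.trans hs₁.2
  have hsub₁ : l '' Icc 0 p ⊆ l '' Icc 0 Λ := image_mono (Icc_subset_Icc_right hpΛ)
  have hsub₂ : l '' Icc p Λ ⊆ l '' Icc 0 Λ := image_mono (Icc_subset_Icc_left hp₀)
  have hne₁ : (l '' Icc 0 p).Nonempty := (nonempty_Icc.2 hp₀).image l
  have hne₂ : (l '' Icc p Λ).Nonempty := (nonempty_Icc.2 hpΛ).image l
  have hcont : ∀ K : Set X, ContinuousOn (fun u => infDist (γ u) K) (Icc 0 M) := fun K =>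
    (continuous_infDist_pt K).comp_continuousOn hγ
  obtain ⟨u, hu, huq⟩ := isPreconnected_Icc.intermediate_value₂ (left_mem_Icc.2 hM)
    (right_mem_Icc.2 hM) (hcont (l '' Icc 0 p)) (hcont (l '' Icc p Λ))
    ((infDist_le_dist_of_mem (mem_image_of_mem l hs₀)).trans
      (h₀.trans_le (infDist_le_infDist_of_subset hsub₂ hne₂)))
    ((infDist_le_dist_of_mem (mem_image_of_mem l hs₁)).trans
      (h₁.trans_le (infDist_le_infDist_of_subset hsub₁ hne₁)))
  obtain ⟨t₁, ht₁, e₁⟩ := (hl.mono le_rfl hpΛ).exists_infDist_eq_dist hp₀ (γ u)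
  obtain ⟨t₂, ht₂, e₂⟩ := (hl.mono hp₀ le_rfl).exists_infDist_eq_dist hpΛ (γ u)
  obtain ⟨t, ht, e⟩ := hl.exists_infDist_eq_dist (hp₀.trans hpΛ) (γ u)
  have hle₁ := infDist_le_infDist_of_subset (x := γ u) hsub₁ hne₁
  have hle : infDist (γ u) (l '' Icc 0 p) ≤ dist (γ u) (l t) := by
    rcases le_total t p with h | h
    · exact infDist_le_dist_of_mem (mem_image_of_mem l ⟨ht.1, h⟩)
    · exact huq.trans_le (infDist_le_dist_of_mem (mem_image_of_mem l ⟨h, ht.2⟩))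
  have heq : infDist (γ u) (l '' Icc 0 p) = infDist (γ u) (l '' Icc 0 Λ) :=
    le_antisymm (hle.trans_eq e.symm) hle₁
  exact ⟨u, hu, t₁, ht₁, t₂, ht₂, e₁.symm.trans heq, e₂.symm.trans (huq.symm.trans heq)⟩

/-- Lemma 4.12: in an `(R,D)`-thin space, let `l` be a segment of
length `Λ ≥ 10R` and `l̄` a segment starting at `l(0)` whose endpoint projects into
`l([0,R]) ∪ l([Λ-R,Λ])`. If `π_l(l̄)` meets `l([3R, Λ-3R])`, then `π_l(l̄)` contains a
`3D`-net of `l([R, Λ-R])`. -/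
theorem thin_segment_proj_net
    {X : Type*} [MetricSpace X] {R D : ℝ} (hX : IsThinSpace X R D)
    {l : ℝ → X} {Λ : ℝ} (hΛ : 10 * R ≤ Λ) (hl : IsSegmentOn l 0 Λ)
    {lb : ℝ → X} {M : ℝ} (hM : 0 ≤ M) (hlb : IsSegmentOn lb 0 M) (h0 : lb 0 = l 0)
    (hproj : metricProj (l '' Set.Icc 0 Λ) (lb M) ⊆
      l '' Set.Icc 0 R ∪ l '' Set.Icc (Λ - R) Λ)
    (hint : (metricProjSet (l '' Set.Icc 0 Λ) (lb '' Set.Icc 0 M) ∩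
      l '' Set.Icc (3 * R) (Λ - 3 * R)).Nonempty) :
    ContainsNetOf (metricProjSet (l '' Set.Icc 0 Λ) (lb '' Set.Icc 0 M))
      (l '' Set.Icc R (Λ - R)) (3 * D) := by
  have hR := hX.R_pos
  have hD := hX.D_pos
  have hRD := hX.twentyD_le_R
  obtain ⟨_, hy, t₀, ht₀, rfl⟩ := hint
  obtain ⟨_, ⟨u₀, hu₀, rfl⟩, -, hd₀⟩ := mem_iUnion₂.1 hy
  have ht₀Λ : t₀ ∈ Icc 0 Λ := ⟨by linarith [ht₀.1], by linarith [ht₀.2]⟩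
  have hdist₀ : dist (lb u₀) (l t₀) < D := hd₀.trans_lt <|
    hX.thin l Λ (by linarith) hl t₀ ⟨by linarith [ht₀.1], by linarith [ht₀.2]⟩ _ hd₀
  have hfrom : ∀ t ∈ Icc 0 Λ, dist (l 0) (l t) = t := fun t ht => by
    rw [hl 0 ⟨le_rfl, ht.1.trans ht.2⟩ t ht, zero_sub, abs_neg, abs_of_nonneg ht.1]
  have hfromb : ∀ u ∈ Icc 0 M, dist (l 0) (lb u) = u := fun u hu => by
    rw [← h0, hlb 0 ⟨le_rfl, hM⟩ u hu, zero_sub, abs_neg, abs_of_nonneg hu.1]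
  have hut₀ : u₀ < t₀ + D ∧ t₀ < u₀ + D := by
    have h₁ := dist_triangle_right (l 0) (lb u₀) (l t₀)
    have h₂ := dist_triangle (l 0) (lb u₀) (l t₀)
    rw [hfrom t₀ ht₀Λ, hfromb u₀ hu₀] at h₁ h₂
    constructor <;> linarith
  have hnear : ∀ u ∈ Icc 0 M, infDist (lb u) (l '' Icc 0 Λ) < |u - u₀| + D := fun u hu => by
    have h₁ := infDist_le_dist_of_mem (x := lb u) (mem_image_of_mem l ht₀Λ)
    have h₂ := dist_triangle (lb u) (lb u₀) (l t₀)
    rw [hlb u hu u₀ hu₀] at h₂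
    linarith
  have hbefore : ∀ u ∈ Icc 0 M, u ≤ u₀ → ∀ t ∈ Icc 0 Λ,
      dist (lb u) (l t) = infDist (lb u) (l '' Icc 0 Λ) → t < t₀ + 2 * D := by
    intro u hu huu t ht hut
    have h₁ := hnear u hu
    have h₂ := dist_triangle (l 0) (lb u) (l t)
    rw [abs_of_nonpos (by linarith)] at h₁
    rw [hfrom t ht, hfromb u hu] at h₂
    linarith [hut₀.1]
  have hafter : ∀ u ∈ Icc 0 M, u₀ ≤ u → ∀ t ∈ Icc 0 Λ,
      dist (lb u) (l t) = infDist (lb u) (l '' Icc 0 Λ) → t₀ - 2 * D < t := by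
    intro u hu huu t ht hut
    have h₁ := hnear u hu
    have h₂ := dist_triangle_right (l 0) (lb u) (l t)
    rw [abs_of_nonneg (by linarith)] at h₁
    rw [hfrom t ht, hfromb u hu] at h₂
    linarith [hut₀.2]
  rintro _ ⟨p, hp, rfl⟩
  have hpΛ : p ∈ Icc 0 Λ := ⟨by linarith [hp.1], by linarith [hp.2]⟩
  have hstart : dist (lb 0) (l 0) = infDist (lb 0) (l '' Icc 0 Λ) := by
    rw [h0, dist_self, infDist_zero_of_mem (mem_image_of_mem l (left_mem_Icc.2 (by linarith)))]
  obtain ⟨s, hs, hds⟩ := hl.exists_infDist_eq_dist (by linarith) (lb M)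
  have hsafter := hafter M ⟨hM, le_rfl⟩ hu₀.2 s hs hds.symm
  have hps : p ≤ s := by
    have hfinj : ∀ s' ∈ Icc 0 Λ, l s' = l s → s' = s := fun s' hs' h => by
      rw [← hfrom s' hs', h, hfrom s hs]
    rcases hproj ⟨mem_image_of_mem l hs, hds.symm⟩ with ⟨s', hs', h⟩ | ⟨s', hs', h⟩
    · have := hfinj s' ⟨hs'.1, by linarith [hs'.2]⟩ h
      linarith [hs'.2, ht₀.1]
    · have := hfinj s' ⟨by linarith [hs'.1], hs'.2⟩ h
      linarith [hs'.1, hp.2]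
  obtain ⟨u, hu, t₁, ht₁, t₂, ht₂, hd₁, hd₂⟩ := hl.exists_nearest_both_sides hM
    hlb.continuousOn ⟨le_rfl, hpΛ.1⟩ ⟨hps, hs.2⟩ hstart hds.symm
  have ht₁Λ : t₁ ∈ Icc 0 Λ := ⟨ht₁.1, ht₁.2.trans hpΛ.2⟩
  have ht₂Λ : t₂ ∈ Icc 0 Λ := ⟨hpΛ.1.trans ht₂.1, ht₂.2⟩
  have hmem : ∀ t ∈ Icc 0 Λ, dist (lb u) (l t) = infDist (lb u) (l '' Icc 0 Λ) →
      |p - t| ≤ 3 * D → ∃ q ∈ metricProjSet (l '' Icc 0 Λ) (lb '' Icc 0 M),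
        dist (l p) q ≤ 3 * D := fun t ht hdt hpt =>
    ⟨l t, mem_iUnion₂.2 ⟨lb u, mem_image_of_mem lb hu, mem_image_of_mem l ht, hdt⟩,
      (hl p hpΛ t ht).trans_le hpt⟩
  rcases le_total u u₀ with huu | huu
  · have hlt := hbefore u hu huu t₂ ht₂Λ hd₂
    refine hmem t₂ ht₂Λ hd₂ (abs_sub_le_iff.2 ⟨by linarith [ht₂.1], ?_⟩)
    rcases le_or_gt t₂ R with h | h
    · linarith [hp.1]
    · have := (abs_sub_lt_iff.1 (hX.abs_sub_lt hl ⟨h, by linarith [ht₀.2]⟩ ht₁Λ hd₂ hd₁)).1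
      linarith [ht₁.2]
  · have hlt := hafter u hu huu t₁ ht₁Λ hd₁
    refine hmem t₁ ht₁Λ hd₁ (abs_sub_le_iff.2 ⟨?_, by linarith [ht₁.2]⟩)
    rcases le_or_gt (Λ - R) t₁ with h | h
    · linarith [hp.2]
    · have := (abs_sub_lt_iff.1 (hX.abs_sub_lt hl ⟨by linarith [ht₀.1], h⟩ ht₂Λ hd₁ hd₂)).2
      linarith [ht₂.1]
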